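/- For every natural number n ≥ 3, one has d(2n−6, 6) = c_n − 5·c_{n−1} + 6·c_{n−2} − c_{n−3}. -/

import Mathlib

open Finset

/-- Step value: `true` is an up-step (+1), `false` a down-step (−1). -/
def dyckStep (b : Bool) : ℤ := if b then 1 else -1

/-- Sum of the first `k` steps of the path `w`. -/
def dyckPSum {m : ℕ} (w : Fin m → Bool) (k : ℕ) : ℤ :=
  ∑ t ∈ Finset.univ.filter (fun t : Fin m => (t : ℕ) < k), dyckStep (w t)

/-- `dyckD i j`: the number of lattice paths of length `i` from `(0,0)` to `(i,j)`
using steps `(1,1)` and `(1,-1)` that never go below the x-axis; equivalently the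
number of `±1`-lists of length `i` all of whose partial sums are nonnegative and
whose total sum is `j`. -/
def dyckD (i j : ℕ) : ℕ :=
  (Finset.univ.filter (fun w : Fin i → Bool =>
    (∀ k ≤ i, 0 ≤ dyckPSum w k) ∧ dyckPSum w i = (j : ℤ))).card

theorem dyckPSum_snoc_of_le {m : ℕ} (w : Fin m → Bool) (b : Bool) {k : ℕ} (hk : k ≤ m) :
    dyckPSum (Fin.snoc w b : Fin (m + 1) → Bool) k = dyckPSum w k := by
  simp only [dyckPSum, Finset.sum_filter, Fin.sum_univ_castSucc, Fin.snoc_castSucc,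
    Fin.val_castSucc, Fin.val_last, if_neg hk.not_gt, add_zero]

theorem dyckPSum_snoc_last {m : ℕ} (w : Fin m → Bool) (b : Bool) :
    dyckPSum (Fin.snoc w b : Fin (m + 1) → Bool) (m + 1) = dyckPSum w m + dyckStep b := by
  simp only [dyckPSum, Finset.sum_filter, Fin.sum_univ_castSucc, Fin.snoc_castSucc,
    Fin.snoc_last, Fin.is_lt, if_true, Order.lt_add_one_iff, Fin.is_le]

theorem dyckPath_snoc_iff {m : ℕ} (w : Fin m → Bool) (b : Bool) (j : ℕ) :
    ((∀ k ≤ m + 1, 0 ≤ dyckPSum (Fin.snoc w b : Fin (m + 1) → Bool) k) ∧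
      dyckPSum (Fin.snoc w b : Fin (m + 1) → Bool) (m + 1) = (j : ℤ)) ↔
    (∀ k ≤ m, 0 ≤ dyckPSum w k) ∧ dyckPSum w m + dyckStep b = (j : ℤ) := by
  rw [dyckPSum_snoc_last]
  refine and_congr_left fun hj => ⟨fun h k hk => ?_, fun h k hk => ?_⟩
  · rw [← dyckPSum_snoc_of_le w b hk]
    exact h k (by omega)
  · rcases Nat.le_succ_iff.mp hk with hk | rfl
    · rw [dyckPSum_snoc_of_le w b hk]
      exact h k hk
    · rw [Nat.succ_eq_add_one, dyckPSum_snoc_last, hj]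
      positivity

theorem dyckD_succ_eq_card_add_card (i j : ℕ) :
    dyckD (i + 1) j =
      (Finset.univ.filter (fun w : Fin i → Bool =>
        (∀ k ≤ i, 0 ≤ dyckPSum w k) ∧ dyckPSum w i + dyckStep true = (j : ℤ))).card +
      (Finset.univ.filter (fun w : Fin i → Bool =>
        (∀ k ≤ i, 0 ≤ dyckPSum w k) ∧ dyckPSum w i + dyckStep false = (j : ℤ))).card := by
  simp only [dyckD, Finset.card_filter]
  rw [← (Fin.snocEquiv fun _ : Fin (i + 1) => Bool).sum_comp, Fintype.sum_prod_type,
    Fintype.sum_bool]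
  congr 1 <;> exact Finset.sum_congr rfl fun w _ => if_congr (dyckPath_snoc_iff w _ j) rfl rfl

theorem dyckD_succ_zero (i : ℕ) : dyckD (i + 1) 0 = dyckD i 1 := by
  rw [dyckD_succ_eq_card_add_card, Finset.card_eq_zero.mpr, zero_add, dyckD]
  · congr! 3 with w
    simp only [dyckStep]
    grind
  · refine Finset.filter_eq_empty_iff.mpr fun w _ h => ?_
    have h0 := h.1 i le_rfl
    have h1 := h.2
    simp only [dyckStep, if_true] at h1
    omega

theorem dyckD_succ_succ (i j : ℕ) :
    dyckD (i + 1) (j + 1) = dyckD i j + dyckD i (j + 2) := by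
  rw [dyckD_succ_eq_card_add_card, dyckD, dyckD]
  congr! 4 with w _ w _ <;> simp only [dyckStep] <;> grind

theorem dyckD_zero_zero : dyckD 0 0 = 1 := by
  simp [dyckD, dyckPSum]

theorem dyckD_eq_zero_of_lt {i j : ℕ} (h : i < j) : dyckD i j = 0 := by
  induction i generalizing j with
  | zero =>
    have h0 : ¬ (0 : ℤ) = j := by omega
    simp [dyckD, dyckPSum, h0]
  | succ i ih =>
    obtain ⟨j, rfl⟩ := Nat.exists_eq_succ_of_ne_zero (by omega : j ≠ 0)
    rw [Nat.succ_eq_add_one, dyckD_succ_succ, ih (by omega), ih (by omega)]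

/-- The ballot formula. -/
theorem dyckD_add_choose {i a v : ℕ} (h : i = a + 2 * v) :
    dyckD i a + i.choose (a + v + 1) = i.choose (a + v) := by
  induction i generalizing a v with
  | zero =>
    obtain ⟨rfl, rfl⟩ : a = 0 ∧ v = 0 := by omega
    simp [dyckD_zero_zero]
  | succ i ih =>
    rcases a with - | b
    · obtain ⟨w, rfl⟩ := Nat.exists_eq_succ_of_ne_zero (by omega : v ≠ 0)
      have h1 := ih (a := 1) (v := w) (by omega)
      have h2 : i.choose (w + 1) = i.choose w :=
        Nat.choose_symm_of_eq_add (by omega)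
      simp only [Nat.succ_eq_add_one, zero_add, dyckD_succ_zero, Nat.choose_succ_succ' i]
      rw [add_comm 1 w] at h1
      omega
    · rw [dyckD_succ_succ, add_right_comm b 1 v, Nat.choose_succ_succ' i,
        Nat.choose_succ_succ' i]
      have h1 := ih (a := b) (v := v) (by omega)
      rcases v with - | w
      · rw [dyckD_eq_zero_of_lt (by omega : i < b + 2), Nat.choose_eq_zero_of_lt
          (by omega : i < b + 0 + 1 + 1)]
        have h2 := Nat.choose_eq_zero_of_lt (by omega : i < b + 0 + 1)
        omega
      · have h2 := ih (a := b + 2) (v := w) (by omega)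
        rw [show b + 2 + w = b + (w + 1) + 1 by ring] at h2
        omega

theorem dyckD_two_mul_zero (m : ℕ) : dyckD (2 * m) 0 = catalan m := by
  have h1 := dyckD_add_choose (i := 2 * m) (a := 0) (v := m) (by omega)
  have h2 := Nat.choose_succ_right_eq (2 * m) m
  have h3 := succ_mul_catalan_eq_centralBinom m
  rw [Nat.centralBinom_eq_two_mul_choose] at h3
  rw [show 2 * m - m = m by omega] at h2
  rw [zero_add] at h1
  refine Nat.eq_of_mul_eq_mul_left m.succ_pos ?_
  rw [Nat.succ_eq_add_one]
  linarith [congrArg (fun x => (m + 1) * x) h1, mul_add (m + 1) (dyckD (2 * m) 0)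
    ((2 * m).choose (m + 1))]

theorem dyckD_add_two_zero (i : ℕ) : dyckD (i + 2) 0 = dyckD i 0 + dyckD i 2 := by
  rw [dyckD_succ_zero, dyckD_succ_succ]

theorem dyckD_add_two_add_two (i j : ℕ) :
    dyckD (i + 2) (j + 2) = dyckD i j + 2 * dyckD i (j + 2) + dyckD i (j + 4) := by
  rw [dyckD_succ_succ, dyckD_succ_succ, dyckD_succ_succ]
  ring

/-- For `n ≥ 3`, `d(2n−6, 6) = cₙ − 5·cₙ₋₁ + 6·cₙ₋₂ − cₙ₋₃`. -/
theorem dyckD_isoline_six (n : ℕ) (hn : 3 ≤ n) :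
    (dyckD (2 * n - 6) 6 : ℤ) =
      catalan n - 5 * catalan (n - 1) + 6 * catalan (n - 2) - catalan (n - 3) := by
  obtain ⟨m, rfl⟩ := Nat.exists_eq_add_of_le' hn
  rw [show 2 * (m + 3) - 6 = 2 * m by omega, show m + 3 - 1 = m + 2 by omega,
    show m + 3 - 2 = m + 1 by omega, show m + 3 - 3 = m by omega]
  simp only [← dyckD_two_mul_zero, mul_add, Nat.reduceMul]
  have h1 := dyckD_add_two_zero (2 * m)
  have h2 := dyckD_add_two_zero (2 * m + 2)
  have h3 := dyckD_add_two_zero (2 * m + 4)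
  have h4 := dyckD_add_two_add_two (2 * m) 0
  have h5 := dyckD_add_two_add_two (2 * m + 2) 0
  have h6 := dyckD_add_two_add_two (2 * m) 2
  simp only [add_assoc, Nat.reduceAdd] at h1 h2 h3 h4 h5 h6
  omega
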